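/- arXiv:1709.04275 — 5 statements merged into one kernel-verified Lean document; each statement's English description precedes it below -/
import Mathlib

section
/- Let R be a commutative ring, p a prime number, n a positive integer, k ≥ 1 an integer and m ≥ 0 an integer. Viewing Γ_{(p^{k+m})}(n,R) as a normal subgroup of Γ_{(p^k)}(n,R), the quotient group Γ_{(p^k)}(n,R)/Γ_{(p^{k+m})}(n,R) is a torsion group: every element has finite order, and in fact the p^m-th power of every element is the identity. -/
open Matrix

/-- The principal congruence subgroup `Γ_I(n,R)` of `GL_n(R)`:
invertible matrices congruent to the identity modulo the ideal `I`. -/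
def congruenceSubgroup (R : Type*) [CommRing R] (n : ℕ) (I : Ideal R) :
    Subgroup (GL (Fin n) R) where
  carrier := {g | ∀ i j, ((g : Matrix (Fin n) (Fin n) R) - 1) i j ∈ I}
  one_mem' := by
    intro i j
    simp
  mul_mem' := by
    intro a b ha hb i j
    have h : ((↑(a * b) : Matrix (Fin n) (Fin n) R) - 1)
        = ((↑a : Matrix (Fin n) (Fin n) R) - 1) * (↑b : Matrix (Fin n) (Fin n) R)
          + ((↑b : Matrix (Fin n) (Fin n) R) - 1) := by
      rw [Units.val_mul]
      noncomm_ring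
    rw [h]
    rw [Matrix.add_apply, Matrix.mul_apply]
    exact I.add_mem (Ideal.sum_mem I fun k _ => I.mul_mem_right _ (ha i k)) (hb i j)
  inv_mem' := by
    intro a ha i j
    have h : ((↑(a⁻¹) : Matrix (Fin n) (Fin n) R) - 1)
        = -((↑(a⁻¹) : Matrix (Fin n) (Fin n) R) * ((↑a : Matrix (Fin n) (Fin n) R) - 1)) := by
      have hmul : (↑(a⁻¹) : Matrix (Fin n) (Fin n) R) * (↑a : Matrix (Fin n) (Fin n) R) = 1 := by
        rw [← Units.val_mul]; simp
      noncomm_ring [hmul]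
    rw [h]
    rw [Matrix.neg_apply, Matrix.mul_apply]
    exact I.neg_mem (Ideal.sum_mem I fun k _ => I.mul_mem_left _ (ha k j))

instance congruenceSubgroup.normal (R : Type*) [CommRing R] (n : ℕ) (I : Ideal R) :
    (congruenceSubgroup R n I).Normal := by
  constructor
  intro g hg h i j
  have hmul : (↑(h * g * h⁻¹) : Matrix (Fin n) (Fin n) R)
      = (↑h : Matrix (Fin n) (Fin n) R) * (↑g : Matrix (Fin n) (Fin n) R)
        * (↑(h⁻¹) : Matrix (Fin n) (Fin n) R) := by
    rw [Units.val_mul, Units.val_mul]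
  have hinv : (↑h : Matrix (Fin n) (Fin n) R) * (↑(h⁻¹) : Matrix (Fin n) (Fin n) R) = 1 := by
    rw [← Units.val_mul]; simp
  have key : ((↑(h * g * h⁻¹) : Matrix (Fin n) (Fin n) R) - 1)
      = (↑h : Matrix (Fin n) (Fin n) R) * ((↑g : Matrix (Fin n) (Fin n) R) - 1)
        * (↑(h⁻¹) : Matrix (Fin n) (Fin n) R) := by
    rw [hmul]
    noncomm_ring [hinv]
  rw [key, Matrix.mul_apply]
  refine Ideal.sum_mem I fun k _ => I.mul_mem_right _ ?_
  rw [Matrix.mul_apply]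
  exact Ideal.sum_mem I fun l _ => I.mul_mem_left _ (hg l k)


theorem step_dvd_aux {S : Type*} [Ring S] (p k : ℕ) (hk : 1 ≤ k) (A : S)
    (h : (p : S) ^ k ∣ A - 1) : (p : S) ^ (k + 1) ∣ A ^ p - 1 := by
  have hp1 : (p : S) ∣ A - 1 := (dvd_pow_self _ (by omega)).trans h
  have hi : ∀ i : ℕ, (p : S) ∣ A ^ i - 1 := fun i => by
    rw [← mul_geom_sum]
    exact hp1.mul_right _
  have hg : (p : S) ∣ ∑ i ∈ Finset.range p, A ^ i := by
    have e : ∑ i ∈ Finset.range p, A ^ i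
        = ∑ i ∈ Finset.range p, (A ^ i - 1) + (p : S) := by
      simp
    rw [e]
    exact dvd_add (Finset.dvd_sum fun i _ => hi i) dvd_rfl
  obtain ⟨B, hB⟩ := h
  obtain ⟨E, hE⟩ := hg
  refine ⟨B * E, ?_⟩
  rw [← mul_geom_sum, hB, hE, pow_succ, mul_assoc, mul_assoc, ← mul_assoc B,
    ← (Nat.cast_commute p B).eq, mul_assoc]

theorem iter_dvd_aux {S : Type*} [Ring S] (p k : ℕ) (hk : 1 ≤ k) (A : S)
    (h : (p : S) ^ k ∣ A - 1) (m : ℕ) : (p : S) ^ (k + m) ∣ A ^ (p ^ m) - 1 := by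
  induction m with
  | zero => simpa using h
  | succ m ih =>
    rw [pow_succ p m, pow_mul]
    exact step_dvd_aux p (k + m) (by omega) _ ih

theorem mem_congr_iff_aux (R : Type*) [CommRing R] (n p k : ℕ) (g : GL (Fin n) R) :
    g ∈ congruenceSubgroup R n (Ideal.span {(p : R) ^ k}) ↔
      (p : Matrix (Fin n) (Fin n) R) ^ k ∣ (g : Matrix (Fin n) (Fin n) R) - 1 := by
  have hs : ∀ B : Matrix (Fin n) (Fin n) R,
      (p : Matrix (Fin n) (Fin n) R) ^ k * B = ((p : R) ^ k) • B := fun B => by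
    rw [← Nat.cast_pow, ← nsmul_eq_mul, ← Nat.cast_pow, Nat.cast_smul_eq_nsmul]
  change (∀ i j, ((g : Matrix (Fin n) (Fin n) R) - 1) i j ∈ Ideal.span {(p : R) ^ k}) ↔ _
  simp only [Ideal.mem_span_singleton]
  constructor
  · intro h
    choose B hB using h
    refine ⟨Matrix.of B, ?_⟩
    rw [hs]
    ext i j
    rw [hB i j]
    rfl
  · rintro ⟨B, hB⟩ i j
    rw [hB, hs]
    exact ⟨B i j, rfl⟩

/-- The quotient `Γ_{(p^k)}(n,R) / Γ_{(p^(k+m))}(n,R)` is a torsion group; in fact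
the `p^m`-th power of every element is the identity. -/
theorem congruenceQuotient_isTorsion (R : Type*) [CommRing R] (p : ℕ) (hp : p.Prime)
    (n : ℕ) (hn : 0 < n) (k : ℕ) (hk : 1 ≤ k) (m : ℕ) :
    ∀ x : congruenceSubgroup R n (Ideal.span {(p : R) ^ k}) ⧸
        ((congruenceSubgroup R n (Ideal.span {(p : R) ^ (k + m)})).subgroupOf
          (congruenceSubgroup R n (Ideal.span {(p : R) ^ k}))),
      IsOfFinOrder x ∧ x ^ (p ^ m) = 1 := by
  intro x
  have key : x ^ (p ^ m) = 1 := by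
    induction x using QuotientGroup.induction_on with
    | H g =>
      rw [← QuotientGroup.mk_pow, QuotientGroup.eq_one_iff, Subgroup.mem_subgroupOf,
        mem_congr_iff_aux]
      have h := iter_dvd_aux p k hk _ ((mem_congr_iff_aux R n p k g.1).1 g.2) m
      simpa using h
  exact ⟨isOfFinOrder_iff_pow_eq_one.2 ⟨p ^ m, pow_pos hp.pos m, key⟩, key⟩
end

section
/- Let R be a commutative ring, p a prime number, n a positive integer, k ≥ 1 and m ≥ 0 integers. Then every finitely generated subgroup of the quotient group Γ_{(p^k)}(n,R)/Γ_{(p^{k+m})}(n,R) is finite. -/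
open Matrix

theorem mem_congruenceSubgroup_span {R : Type*} [CommRing R] {n : ℕ} {c : R}
    {g : GL (Fin n) R} : g ∈ congruenceSubgroup R n (Ideal.span {c}) ↔
      ∃ Y : Matrix (Fin n) (Fin n) R, (g : Matrix (Fin n) (Fin n) R) = 1 + c • Y := by
  constructor
  · intro h
    have h' : ∀ i j, ∃ y, ((g : Matrix (Fin n) (Fin n) R) - 1) i j = c * y := fun i j =>
      Ideal.mem_span_singleton.1 (h i j)
    choose Y hY using h'
    refine ⟨Matrix.of Y, ?_⟩
    rw [← sub_eq_iff_eq_add']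
    ext i j
    simpa using hY i j
  · rintro ⟨Y, hY⟩ i j
    rw [Ideal.mem_span_singleton, hY]
    exact ⟨Y i j, by simp⟩

theorem congr_commutator_mem {R : Type*} [CommRing R] {n : ℕ} (p : R) {j : ℕ} (hj : 1 ≤ j)
    {a b : GL (Fin n) R} (ha : a ∈ congruenceSubgroup R n (Ideal.span {p ^ j}))
    (hb : b ∈ congruenceSubgroup R n (Ideal.span {p ^ j})) :
    (a * b)⁻¹ * (b * a) ∈ congruenceSubgroup R n (Ideal.span {p ^ (j + 1)}) := by
  rw [mem_congruenceSubgroup_span] at *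
  obtain ⟨A, hA⟩ := ha
  obtain ⟨B, hB⟩ := hb
  obtain ⟨i, rfl⟩ := Nat.exists_eq_add_of_le hj
  refine ⟨((a * b)⁻¹ : GL (Fin n) R) * (p ^ i • (B * A - A * B)), ?_⟩
  have h1 : (((a * b)⁻¹ : GL (Fin n) R) : Matrix (Fin n) (Fin n) R) *
      ((a * b : GL (Fin n) R) : Matrix (Fin n) (Fin n) R) = 1 := by
    rw [← Units.val_mul]; simp
  have h2 : ((b * a : GL (Fin n) R) : Matrix (Fin n) (Fin n) R) =
      ((a * b : GL (Fin n) R) : Matrix (Fin n) (Fin n) R) +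
        p ^ (1 + i + 1) • (p ^ i • (B * A - A * B)) := by
    rw [Units.val_mul, Units.val_mul, hA, hB, smul_smul, ← pow_add]
    simp only [mul_add, add_mul, one_mul, mul_one, smul_mul_smul_comm, ← pow_add, smul_sub]
    have : 1 + i + (1 + i) = 1 + i + 1 + i := by ring
    rw [this]
    abel
  rw [Units.val_mul (a * b)⁻¹, h2, mul_add, h1, mul_smul_comm]

theorem congr_pow_eq {R : Type*} [CommRing R] {n : ℕ} (c : R) (A : Matrix (Fin n) (Fin n) R)
    (t : ℕ) : ∃ Y, (1 + c • A) ^ t = 1 + (t : R) • c • A + (c * c) • Y := by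
  induction t with
  | zero => exact ⟨0, by simp⟩
  | succ t ih =>
    obtain ⟨Y, hY⟩ := ih
    refine ⟨(t : R) • (A * A) + Y + c • (Y * A), ?_⟩
    rw [pow_succ, hY]
    simp only [mul_add, add_mul, one_mul, mul_one, smul_mul_assoc, mul_smul_comm, smul_add,
      smul_smul]
    push_cast
    module

theorem congr_pow_mem {R : Type*} [CommRing R] {n : ℕ} (p : ℕ) {j : ℕ} (hj : 1 ≤ j)
    {a : GL (Fin n) R} (ha : a ∈ congruenceSubgroup R n (Ideal.span {(p : R) ^ j})) :
    a ^ p ∈ congruenceSubgroup R n (Ideal.span {(p : R) ^ (j + 1)}) := by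
  rw [mem_congruenceSubgroup_span] at *
  obtain ⟨A, hA⟩ := ha
  obtain ⟨i, rfl⟩ := Nat.exists_eq_add_of_le hj
  obtain ⟨Y, hY⟩ := congr_pow_eq ((p : R) ^ (1 + i)) A p
  refine ⟨A + (p : R) ^ i • Y, ?_⟩
  rw [Units.val_pow_eq_pow_val, hA, hY]
  module

theorem congr_step {R : Type*} [CommRing R] {n : ℕ} {p : ℕ} (hp : p.Prime) {j : ℕ} (hj : 1 ≤ j)
    {F : Type*} [Group F] [Group.FG F] (f : F →* GL (Fin n) R)
    (hf : ∀ x, f x ∈ congruenceSubgroup R n (Ideal.span {(p : R) ^ j})) :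
    ((congruenceSubgroup R n (Ideal.span {(p : R) ^ (j + 1)})).comap f).FiniteIndex := by
  set N := (congruenceSubgroup R n (Ideal.span {(p : R) ^ (j + 1)})).comap f with hN
  let _ : CommGroup (F ⧸ N) :=
    { (inferInstance : Group (F ⧸ N)) with
      mul_comm := by
        intro x y
        induction x using QuotientGroup.induction_on with | _ x
        induction y using QuotientGroup.induction_on with | _ y
        rw [← QuotientGroup.mk_mul, ← QuotientGroup.mk_mul, QuotientGroup.eq, hN,
          Subgroup.mem_comap]
        simpa only [map_mul, map_inv] using congr_commutator_mem (p : R) hj (hf x) (hf y) }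
  have : Finite (F ⧸ N) := by
    apply CommGroup.finite_of_fg_isMulTorsion
    intro x
    induction x using QuotientGroup.induction_on with | _ x
    rw [isOfFinOrder_iff_pow_eq_one]
    refine ⟨p, hp.pos, ?_⟩
    have : x ^ p ∈ N := by
      rw [hN, Subgroup.mem_comap, map_pow]
      exact congr_pow_mem p hj (hf x)
    exact (QuotientGroup.eq_one_iff (N := N) (x ^ p)).2 this
  exact Subgroup.finiteIndex_of_finite_quotient

theorem congr_finiteIndex {R : Type*} [CommRing R] {n : ℕ} {p : ℕ} (hp : p.Prime) {k : ℕ}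
    (hk : 1 ≤ k) (m : ℕ) {F : Type*} [Group F] [Group.FG F] (f : F →* GL (Fin n) R)
    (hf : ∀ x, f x ∈ congruenceSubgroup R n (Ideal.span {(p : R) ^ k})) :
    ((congruenceSubgroup R n (Ideal.span {(p : R) ^ (k + m)})).comap f).FiniteIndex := by
  induction m with
  | zero =>
    have : (congruenceSubgroup R n (Ideal.span {(p : R) ^ (k + 0)})).comap f = ⊤ := by
      rw [eq_top_iff]
      exact fun x _ => hf x
    rw [this]
    infer_instance
  | succ m ih =>
    set N := (congruenceSubgroup R n (Ideal.span {(p : R) ^ (k + m)})).comap f with hN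
    have h := congr_step hp (j := k + m) (by omega) (f.comp N.subtype) (fun x => x.2)
    have hle : (congruenceSubgroup R n (Ideal.span {(p : R) ^ (k + (m + 1))})).comap f ≤ N := by
      intro x hx i j
      refine (Ideal.span_singleton_le_span_singleton.2 ?_) (hx i j)
      exact pow_dvd_pow _ (by omega)
    constructor
    rw [← Subgroup.relIndex_mul_index hle]
    exact mul_ne_zero h.index_ne_zero ih.index_ne_zero

/-- Every finitely generated subgroup of `Γ_{(p^k)}(n,R) / Γ_{(p^(k+m))}(n,R)` is finite. -/
theorem congruenceQuotient_fg_subgroup_finite (R : Type*) [CommRing R] (p : ℕ) (hp : p.Prime)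
    (n : ℕ) (hn : 0 < n) (k : ℕ) (hk : 1 ≤ k) (m : ℕ) :
    ∀ H : Subgroup (congruenceSubgroup R n (Ideal.span {(p : R) ^ k}) ⧸
        ((congruenceSubgroup R n (Ideal.span {(p : R) ^ (k + m)})).subgroupOf
          (congruenceSubgroup R n (Ideal.span {(p : R) ^ k})))),
      H.FG → Finite H := by
  set G := congruenceSubgroup R n (Ideal.span {(p : R) ^ k}) with hG
  set N := (congruenceSubgroup R n (Ideal.span {(p : R) ^ (k + m)})).subgroupOf G with hN
  intro H hH
  obtain ⟨s, rfl, hs⟩ := (Subgroup.fg_iff H).1 hH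
  have : Finite s := hs
  let t : Set G := Quotient.out '' s
  have ht : t.Finite := hs.image _
  have : Finite t := ht
  let K := Subgroup.closure t
  have hK : K.map (QuotientGroup.mk' N) = Subgroup.closure s := by
    rw [MonoidHom.map_closure]
    congr 1
    ext x
    simp [t]
  have hfin := congr_finiteIndex hp hk m (G.subtype.comp K.subtype) (fun x => x.1.2)
  let φ : K →* G ⧸ N := (QuotientGroup.mk' N).comp K.subtype
  have hker : φ.ker = (congruenceSubgroup R n (Ideal.span {(p : R) ^ (k + m)})).comap
      (G.subtype.comp K.subtype) := by
    ext x
    rw [MonoidHom.mem_ker]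
    exact QuotientGroup.eq_one_iff (N := N) (x : G)
  rw [← hker] at hfin
  have hrange : φ.range = Subgroup.closure s := by
    rw [← hK, MonoidHom.range_comp, Subgroup.range_subtype]
  rw [← hrange]
  exact Finite.of_equiv _ (QuotientGroup.quotientKerEquivRange φ).toEquiv
end

section
/- Let p be a prime number, R a p-adically complete commutative ring, and n, k positive integers. The group homomorphism GL_n(R) → GL_n(R/(p^k)) induced by the reduction map R → R/(p^k) is surjective, and its kernel is exactly the principal congruence subgroup Γ_{(p^k)}(n,R). Consequently there is a group isomorphism GL_n(R)/Γ_{(p^k)}(n,R) ≅ GL_n(R/(p^k)). -/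
open Matrix

/-- For a `p`-adically complete ring `R`, the reduction map
`GL_n(R) → GL_n(R/(p^k))` is surjective with kernel the principal congruence subgroup,
giving `GL_n(R)/Γ_{(p^k)}(n,R) ≅ GL_n(R/(p^k))`. -/
theorem glnMap_surjective_ker_congruence (p : ℕ) (hp : p.Prime) (R : Type*) [CommRing R]
    [IsAdicComplete (Ideal.span {(p : R)}) R] (n k : ℕ) (hn : 0 < n) (hk : 1 ≤ k) :
    Function.Surjective
        (Matrix.GeneralLinearGroup.map (n := Fin n)
          (Ideal.Quotient.mk (Ideal.span {(p : R) ^ k}))) ∧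
      (Matrix.GeneralLinearGroup.map (n := Fin n)
          (Ideal.Quotient.mk (Ideal.span {(p : R) ^ k}))).ker
        = congruenceSubgroup R n (Ideal.span {(p : R) ^ k}) ∧
      Nonempty ((GL (Fin n) R ⧸ congruenceSubgroup R n (Ideal.span {(p : R) ^ k})) ≃*
        GL (Fin n) (R ⧸ Ideal.span {(p : R) ^ k})) := by
  have hle : Ideal.span {(p : R) ^ k} ≤ (⊥ : Ideal R).jacobson := by
    refine le_trans ?_ (IsAdicComplete.le_jacobson_bot (Ideal.span {(p : R)}))
    rw [Ideal.span_singleton_le_span_singleton]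
    exact dvd_pow_self _ (by omega)
  have hloc := isLocalHom_of_le_jacobson_bot _ hle
  have hsurj : Function.Surjective
        (Matrix.GeneralLinearGroup.map (n := Fin n)
          (Ideal.Quotient.mk (Ideal.span {(p : R) ^ k}))) := by
    intro g
    choose f hf using Ideal.Quotient.mk_surjective (I := Ideal.span {(p : R) ^ k})
    let M : Matrix (Fin n) (Fin n) R := Matrix.of fun i j => f (g.val i j)
    have hM : (Ideal.Quotient.mk (Ideal.span {(p : R) ^ k})).mapMatrix M = g.val := by
      ext i j
      simp [M, hf]
    have hdet : IsUnit M.det := by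
      apply isUnit_of_map_unit (Ideal.Quotient.mk (Ideal.span {(p : R) ^ k}))
      rw [RingHom.map_det, hM]
      exact (Matrix.isUnit_iff_isUnit_det _).1 g.isUnit
    obtain ⟨u, hu⟩ := (Matrix.isUnit_iff_isUnit_det _).2 hdet
    refine ⟨u, Units.ext ?_⟩
    rw [← hM, ← hu]
    rfl
  have hker : (Matrix.GeneralLinearGroup.map (n := Fin n)
          (Ideal.Quotient.mk (Ideal.span {(p : R) ^ k}))).ker
        = congruenceSubgroup R n (Ideal.span {(p : R) ^ k}) := by
    ext g
    rw [MonoidHom.mem_ker]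
    change _ ↔ ∀ i j, ((g : Matrix (Fin n) (Fin n) R) - 1) i j ∈ Ideal.span {(p : R) ^ k}
    rw [Units.ext_iff, ← Matrix.ext_iff]
    refine forall_congr' fun i => forall_congr' fun j => ?_
    rw [← Ideal.Quotient.eq_zero_iff_mem, Matrix.sub_apply, map_sub, sub_eq_zero]
    have h1 : Ideal.Quotient.mk (Ideal.span {(p : R) ^ k}) ((1 : Matrix (Fin n) (Fin n) R) i j)
        = (1 : Matrix (Fin n) (Fin n) (R ⧸ Ideal.span {(p : R) ^ k})) i j := by
      simp only [Matrix.one_apply]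
      split_ifs <;> simp
    rw [h1]
    rfl
  exact ⟨hsurj, hker, ⟨(QuotientGroup.quotientMulEquivOfEq hker.symm).trans
    (QuotientGroup.quotientKerEquivOfSurjective _ hsurj)⟩⟩
end

section
/- Let R be a commutative ring, p a prime number, n a positive integer, k ≥ 1 an integer, and g ∈ GL_n(R) such that every entry of g − 1 lies in the ideal (p^k). Then for all integers a and b and every natural number m, if p^m divides a − b in ℤ, then every entry of the matrix g^a − g^b lies in the ideal generated by p^{k+m}, where g^a and g^b denote (possibly negative) integer powers of g in the group GL_n(R). -/
open Matrix

/-- Natural-number scalars move past left multiplication. -/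
lemma aux_dvd_mul_left {M : Type*} [Ring M] (d : ℕ) (x y : M) (h : (d : M) ∣ y) :
    (d : M) ∣ x * y := by
  obtain ⟨z, rfl⟩ := h
  exact ⟨x * z, by rw [← mul_assoc, ← mul_assoc, (Nat.cast_commute d x).eq]⟩

lemma aux_pow {M : Type*} [Ring M] (d : ℕ) (x : M) (h : (d : M) ∣ x - 1) (c : ℕ) :
    (d : M) ∣ x ^ c - 1 := by
  rw [← geom_sum_mul]
  exact aux_dvd_mul_left d _ _ h

lemma aux_step {M : Type*} [Ring M] (p k : ℕ) (hk : 1 ≤ k) (x : M)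
    (h : ((p ^ k : ℕ) : M) ∣ x - 1) : ((p ^ (k + 1) : ℕ) : M) ∣ x ^ p - 1 := by
  have hp : (p : M) ∣ x - 1 := by
    refine dvd_trans ?_ h
    exact_mod_cast Nat.cast_dvd_cast (dvd_pow_self p (by omega : k ≠ 0))
  have hs : (p : M) ∣ ∑ i ∈ Finset.range p, x ^ i := by
    have e : ∑ i ∈ Finset.range p, x ^ i = ∑ i ∈ Finset.range p, (x ^ i - 1) + (p : M) := by
      simp
    rw [e]
    exact dvd_add (Finset.dvd_sum fun i _ => aux_pow p x hp i) dvd_rfl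
  rw [← geom_sum_mul]
  obtain ⟨z, hz⟩ := hs
  rw [hz, mul_assoc, pow_succ', Nat.cast_mul]
  exact mul_dvd_mul_left _ (aux_dvd_mul_left _ _ _ h)

lemma aux_iter {M : Type*} [Ring M] (p k : ℕ) (hk : 1 ≤ k) (x : M)
    (h : ((p ^ k : ℕ) : M) ∣ x - 1) (m : ℕ) :
    ((p ^ (k + m) : ℕ) : M) ∣ x ^ (p ^ m) - 1 := by
  induction m with
  | zero => simpa using h
  | succ m ih =>
    rw [pow_succ p m, pow_mul, ← add_assoc]
    exact aux_step p (k + m) (by omega) _ ih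

lemma aux_zpow {M : Type*} [Ring M] (d : ℕ) (u : Mˣ) (h : (d : M) ∣ (u : M) - 1) (c : ℤ) :
    (d : M) ∣ ((u ^ c : Mˣ) : M) - 1 := by
  have hinv : (d : M) ∣ ((u⁻¹ : Mˣ) : M) - 1 := by
    have e : ((u⁻¹ : Mˣ) : M) - 1 = -(((u⁻¹ : Mˣ) : M) * ((u : M) - 1)) := by
      rw [mul_sub, Units.inv_mul]; simp
    rw [e]
    exact (dvd_neg).2 (aux_dvd_mul_left _ _ _ h)
  obtain ⟨c, rfl | rfl⟩ := c.eq_nat_or_neg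
  · simpa using aux_pow d _ h c
  · simpa using aux_pow d _ hinv c

lemma aux_entry {R : Type*} [CommRing R] {n : ℕ} (d : ℕ) (A : Matrix (Fin n) (Fin n) R) :
    (d : Matrix (Fin n) (Fin n) R) ∣ A ↔ ∀ i j, (d : R) ∣ A i j := by
  have key : ∀ B : Matrix (Fin n) (Fin n) R, ∀ i j,
      ((d : Matrix (Fin n) (Fin n) R) * B) i j = (d : R) * B i j := by
    intro B i j
    rw [← nsmul_eq_mul, Matrix.smul_apply, nsmul_eq_mul]
  constructor
  · rintro ⟨B, rfl⟩ i j
    exact ⟨B i j, key B i j⟩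
  · intro h
    choose B hB using h
    refine ⟨Matrix.of B, ?_⟩
    ext i j
    rw [key, hB]
    rfl

/-- If `g ∈ GL_n(R)` is congruent to the identity mod `(p^k)` and `p^m ∣ a - b` in `ℤ`,
then `g^a ≡ g^b` modulo `(p^(k+m))` entrywise. -/
theorem zpow_sub_zpow_mem_of_dvd (R : Type*) [CommRing R] (p : ℕ) (hp : p.Prime)
    (n : ℕ) (hn : 0 < n) (k : ℕ) (hk : 1 ≤ k) (g : GL (Fin n) R)
    (hg : ∀ i j, ((g : Matrix (Fin n) (Fin n) R) - 1) i j ∈ Ideal.span {(p : R) ^ k})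
    (a b : ℤ) (m : ℕ) (hab : (p : ℤ) ^ m ∣ a - b) :
    ∀ i j, (((g ^ a : GL (Fin n) R) : Matrix (Fin n) (Fin n) R)
        - ((g ^ b : GL (Fin n) R) : Matrix (Fin n) (Fin n) R)) i j
      ∈ Ideal.span {(p : R) ^ (k + m)} := by
  simp only [Ideal.mem_span_singleton, ← Nat.cast_pow] at hg ⊢
  rw [← aux_entry] at hg ⊢
  obtain ⟨c, hc⟩ := hab
  obtain rfl : a = b + (p : ℤ) ^ m * c := by linarith
  have h1 := aux_iter p k hk _ hg m
  rw [← Units.val_pow_eq_pow_val] at h1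
  have h2 := aux_zpow _ _ h1 c
  have e : g ^ (b + (p : ℤ) ^ m * c) = g ^ b * (g ^ (p ^ m)) ^ c := by
    rw [_root_.zpow_add, _root_.zpow_mul, ← Nat.cast_pow, _root_.zpow_natCast]
  rw [e, Units.val_mul, ← mul_sub_one]
  exact aux_dvd_mul_left _ _ _ h2
end

section
/- Let p be a prime number, R a p-adically complete commutative ring, n a positive integer, k ≥ 1 an integer, and g ∈ GL_n(R) such that every entry of g − 1 lies in the ideal (p^k). Then there exists a unique function f : ℤ_p → GL_n(R) from the p-adic integers such that (i) f(a) = g^a for every integer a (under the canonical inclusion of ℤ into ℤ_p), and (ii) for all x, y ∈ ℤ_p and every natural number m, if p^m divides x − y in ℤ_p, then every entry of f(x) − f(y) lies in the ideal generated by p^{k+m}. Moreover this f is a group homomorphism from the additive group (ℤ_p, +) to GL_n(R), and every entry of f(x) − 1 lies in (p^k) for every x ∈ ℤ_p. -/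
open Matrix

section aux
variable {A : Type*} [Ring A]

theorem aux_dvd_mul (p m : ℕ) (y x : A) (h : (p : A) ^ m ∣ x) : (p : A) ^ m ∣ y * x := by
  obtain ⟨z, rfl⟩ := h
  refine ⟨y * z, ?_⟩
  rw [← mul_assoc, ← mul_assoc, ((Nat.cast_commute p y).pow_left m).eq]

theorem aux_pow_p (p j : ℕ) (hj : 1 ≤ j) (h : A) (hh : (p : A) ^ j ∣ h - 1) :
    (p : A) ^ (j + 1) ∣ h ^ p - 1 := by
  have h1 : (p : A) ∣ h - 1 := (dvd_pow_self _ (by omega)).trans hh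
  have h2 : ∀ i : ℕ, (p : A) ∣ h ^ i - 1 := fun i => by
    rw [← mul_geom_sum]; exact h1.mul_right _
  have h3 : (p : A) ∣ ∑ i ∈ Finset.range p, h ^ i := by
    have : ∑ i ∈ Finset.range p, h ^ i = ∑ i ∈ Finset.range p, (h ^ i - 1) + (p : A) := by
      simp
    rw [this]
    exact dvd_add (Finset.dvd_sum fun i _ => h2 i) dvd_rfl
  rw [← mul_geom_sum]
  obtain ⟨u, hu⟩ := hh
  obtain ⟨v, hv⟩ := h3
  refine ⟨u * v, ?_⟩
  rw [hu, hv, pow_succ, mul_assoc, mul_assoc, ← mul_assoc u, ← (Nat.cast_commute p u).eq, mul_assoc]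

theorem aux_pow_pm (p k : ℕ) (hk : 1 ≤ k) (h : A) (hh : (p : A) ^ k ∣ h - 1) (m : ℕ) :
    (p : A) ^ (k + m) ∣ h ^ (p ^ m) - 1 := by
  induction m with
  | zero => simpa using hh
  | succ m ih =>
    rw [pow_succ p m, pow_mul, ← add_assoc]
    exact aux_pow_p p (k + m) (by omega) _ ih

theorem aux_inv (p j : ℕ) (u : Aˣ) (hu : (p : A) ^ j ∣ (u : A) - 1) :
    (p : A) ^ j ∣ ((u⁻¹ : Aˣ) : A) - 1 := by
  have : ((u⁻¹ : Aˣ) : A) - 1 = - (((u⁻¹ : Aˣ) : A) * ((u : A) - 1)) := by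
    rw [mul_sub]; simp
  rw [this, dvd_neg]
  exact aux_dvd_mul _ _ _ _ hu

theorem aux_zpow_s9 (p j : ℕ) (u : Aˣ) (hu : (p : A) ^ j ∣ (u : A) - 1) (b : ℤ) :
    (p : A) ^ j ∣ ((u ^ b : Aˣ) : A) - 1 := by
  have hn : ∀ i : ℕ, (p : A) ^ j ∣ ((u ^ i : Aˣ) : A) - 1 := fun i => by
    rw [Units.val_pow_eq_pow_val, ← mul_geom_sum]; exact hu.mul_right _
  obtain ⟨i, rfl | rfl⟩ := b.eq_nat_or_neg
  · simpa using hn i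
  · rw [_root_.zpow_neg, zpow_natCast]; exact aux_inv p j _ (hn i)

theorem aux_cong (p k : ℕ) (hk : 1 ≤ k) (u : Aˣ) (hu : (p : A) ^ k ∣ (u : A) - 1) (m : ℕ)
    (a b : ℤ) (hab : (p : ℤ) ^ m ∣ a - b) :
    (p : A) ^ (k + m) ∣ ((u ^ a : Aˣ) : A) - ((u ^ b : Aˣ) : A) := by
  obtain ⟨c, hc⟩ := hab
  obtain rfl : a = b + (p : ℤ) ^ m * c := by omega
  have h1 : (p : A) ^ (k + m) ∣ ((u ^ (p ^ m) : Aˣ) : A) - 1 := by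
    rw [Units.val_pow_eq_pow_val]; exact aux_pow_pm p k hk _ hu m
  have h2 := aux_zpow_s9 p (k + m) _ h1 c
  have h3 : u ^ (b + (p : ℤ) ^ m * c) = u ^ b * (u ^ (p ^ m)) ^ c := by
    rw [_root_.zpow_add, _root_.zpow_mul, ← zpow_natCast u (p ^ m)]; push_cast; rfl
  rw [h3, Units.val_mul]
  have := aux_dvd_mul p (k + m) ((u ^ b : Aˣ) : A) _ h2
  rwa [mul_sub, mul_one] at this

/-- Abstract version over a ring that is Hausdorff and complete for the powers of `p`. -/
theorem aux_main (p : ℕ) [hp : Fact p.Prime]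
    (haus : ∀ x : A, (∀ m : ℕ, (p : A) ^ m ∣ x) → x = 0)
    (prec : ∀ s : ℕ → A, (∀ m l, m ≤ l → (p : A) ^ m ∣ s m - s l) →
      ∃ L, ∀ m, (p : A) ^ m ∣ s m - L)
    (k : ℕ) (hk : 1 ≤ k) (g : Aˣ) (hg : (p : A) ^ k ∣ (g : A) - 1) :
    ∃ f : ℤ_[p] → Aˣ,
      (∀ a : ℤ, f (a : ℤ_[p]) = g ^ a) ∧
      (∀ x y : ℤ_[p], ∀ m : ℕ, (p : ℤ_[p]) ^ m ∣ x - y →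
        (p : A) ^ (k + m) ∣ (f x : A) - (f y : A)) ∧
      (∀ x y : ℤ_[p], f (x + y) = f x * f y) ∧
      (∀ x : ℤ_[p], (p : A) ^ k ∣ (f x : A) - 1) ∧
      (∀ f' : ℤ_[p] → Aˣ,
        (∀ a : ℤ, f' (a : ℤ_[p]) = g ^ a) →
        (∀ x y : ℤ_[p], ∀ m : ℕ, (p : ℤ_[p]) ^ m ∣ x - y →
          (p : A) ^ (k + m) ∣ (f' x : A) - (f' y : A)) →
        f' = f) := by
  have haus' : ∀ x y : A, (∀ m : ℕ, (p : A) ^ (k + m) ∣ x - y) → x = y := fun x y h =>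
    sub_eq_zero.1 (haus _ fun m => (pow_dvd_pow _ (by omega)).trans (h m))
  have happr : ∀ (x : ℤ_[p]) (m : ℕ), (p : ℤ_[p]) ^ m ∣ x - ((x.appr m : ℤ) : ℤ_[p]) := by
    intro x m
    have := PadicInt.appr_spec m x
    rw [Ideal.mem_span_singleton] at this
    simpa using this
  have hint : ∀ (x : ℤ_[p]) (a b : ℤ) (m : ℕ), (p : ℤ_[p]) ^ m ∣ x - a →
      (p : ℤ_[p]) ^ m ∣ x - b →
      (p : A) ^ (k + m) ∣ ((g ^ a : Aˣ) : A) - ((g ^ b : Aˣ) : A) := by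
    intro x a b m ha hb
    apply aux_cong p k hk g hg m
    rw [← PadicInt.pow_p_dvd_int_iff]
    have := dvd_sub hb ha
    push_cast
    simpa using this
  have hL : ∀ x : ℤ_[p], ∃ L : A, ∀ (a : ℤ) (m : ℕ), (p : ℤ_[p]) ^ m ∣ x - a →
      (p : A) ^ (k + m) ∣ L - ((g ^ a : Aˣ) : A) := by
    intro x
    obtain ⟨L, hL⟩ := prec (fun m => ((g ^ (x.appr m : ℤ) : Aˣ) : A)) (by
      intro m l hml
      exact (pow_dvd_pow _ (by omega)).trans (hint x _ _ m (happr x m)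
        ((pow_dvd_pow _ hml).trans (happr x l))))
    refine ⟨L, fun a m ha => ?_⟩
    have h1 := hL (k + m)
    have h2 := hint x (x.appr (k + m)) a m
      ((pow_dvd_pow _ (by omega)).trans (happr x (k + m))) ha
    have := dvd_sub h2 h1
    simpa using this
  choose L hL using hL
  have Lint : ∀ a : ℤ, L a = ((g ^ a : Aˣ) : A) := fun a =>
    haus' _ _ fun m => hL a a m (by simp)
  have Ladd : ∀ x y, L (x + y) = L x * L y := by
    intro x y
    refine haus' _ _ fun m => ?_
    have ha := happr x m
    have hb := happr y m
    generalize (x.appr m : ℤ) = a at ha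
    generalize (y.appr m : ℤ) = b at hb
    have h1 := hL (x + y) (a + b) m (by
      have := dvd_add ha hb
      push_cast
      rwa [sub_add_sub_comm] at this)
    have h2 := hL x a m ha
    have h3 := hL y b m hb
    have e : L (x + y) - L x * L y = (L (x + y) - ((g ^ (a + b) : Aˣ) : A))
        - ((L x - ((g ^ a : Aˣ) : A)) * L y + ((g ^ a : Aˣ) : A) * (L y - ((g ^ b : Aˣ) : A))) := by
      rw [_root_.zpow_add, Units.val_mul]; noncomm_ring
    rw [e]
    exact dvd_sub h1 (dvd_add (h2.mul_right _) (aux_dvd_mul _ _ _ _ h3))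
  have L0 : L 0 = 1 := by simpa using Lint 0
  have Lcong : ∀ x y : ℤ_[p], ∀ m : ℕ, (p : ℤ_[p]) ^ m ∣ x - y →
        (p : A) ^ (k + m) ∣ L x - L y := by
    intro x y m h
    have ha := happr x m
    have h1 := hL x _ m ha
    have h2 := hL y (x.appr m) m (by simpa using dvd_sub ha h)
    simpa using dvd_sub h1 h2
  refine ⟨fun x => ⟨L x, L (-x), by rw [← Ladd]; simpa using L0, by rw [← Ladd]; simpa using L0⟩,
    fun a => Units.ext (Lint a), Lcong, fun x y => Units.ext (Ladd x y), fun x => ?_, ?_⟩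
  · have := Lcong x 0 0 (by simp)
    simpa [L0] using this
  · intro f' h1 h2
    funext x
    refine Units.ext (haus' _ _ fun m => ?_)
    have ha := happr x m
    have h3 := h2 _ _ m ha
    rw [h1] at h3
    have h4 := hL x _ m ha
    simpa using dvd_sub h3 h4

end aux

theorem aux_matrix {R : Type*} [CommRing R] (p n m : ℕ) (M : Matrix (Fin n) (Fin n) R) :
    (p : Matrix (Fin n) (Fin n) R) ^ m ∣ M ↔ ∀ i j, M i j ∈ Ideal.span {(p : R) ^ m} := by
  have e : ∀ N : Matrix (Fin n) (Fin n) R,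
      (p : Matrix (Fin n) (Fin n) R) ^ m * N = ((p : R) ^ m) • N := by
    intro N
    rw [← Nat.cast_pow, ← nsmul_eq_mul, ← Nat.cast_pow, Nat.cast_smul_eq_nsmul]
  simp only [Ideal.mem_span_singleton]
  constructor
  · rintro ⟨N, rfl⟩ i j
    rw [e]
    exact ⟨N i j, by simp⟩
  · intro h
    choose N hN using h
    refine ⟨Matrix.of N, ?_⟩
    rw [e]
    ext i j
    simp [hN i j]

/-- Each element of a principal congruence subgroup of `GL_n(R)`, for `R` a
`p`-adically complete ring, admits a unique system of continuous `p`-adic powers: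
there is a unique map `f : ℤ_p → GL_n(R)` extending the integer powers of `g` and
satisfying the natural `p`-adic congruences; moreover `f` is a homomorphism from
`(ℤ_p, +)` and takes values in the congruence subgroup. -/
theorem exists_unique_padic_power_map (p : ℕ) [hp : Fact p.Prime] (R : Type*) [CommRing R]
    [IsAdicComplete (Ideal.span {(p : R)}) R] (n : ℕ) (hn : 0 < n) (k : ℕ) (hk : 1 ≤ k)
    (g : GL (Fin n) R)
    (hg : ∀ i j, ((g : Matrix (Fin n) (Fin n) R) - 1) i j ∈ Ideal.span {(p : R) ^ k}) :
    ∃ f : ℤ_[p] → GL (Fin n) R,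
      (∀ a : ℤ, f (a : ℤ_[p]) = g ^ a) ∧
      (∀ x y : ℤ_[p], ∀ m : ℕ, (p : ℤ_[p]) ^ m ∣ x - y →
        ∀ i j, (((f x : GL (Fin n) R) : Matrix (Fin n) (Fin n) R)
            - ((f y : GL (Fin n) R) : Matrix (Fin n) (Fin n) R)) i j
          ∈ Ideal.span {(p : R) ^ (k + m)}) ∧
      (∀ x y : ℤ_[p], f (x + y) = f x * f y) ∧
      (∀ x : ℤ_[p], ∀ i j, ((f x : Matrix (Fin n) (Fin n) R) - 1) i j
          ∈ Ideal.span {(p : R) ^ k}) ∧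
      (∀ f' : ℤ_[p] → GL (Fin n) R,
        (∀ a : ℤ, f' (a : ℤ_[p]) = g ^ a) →
        (∀ x y : ℤ_[p], ∀ m : ℕ, (p : ℤ_[p]) ^ m ∣ x - y →
          ∀ i j, (((f' x : GL (Fin n) R) : Matrix (Fin n) (Fin n) R)
              - ((f' y : GL (Fin n) R) : Matrix (Fin n) (Fin n) R)) i j
            ∈ Ideal.span {(p : R) ^ (k + m)}) →
        f' = f) := by
  have hsm : ∀ (m : ℕ) (x y : R), x ≡ y [SMOD (Ideal.span {(p : R)} ^ m • ⊤ : Submodule R R)] ↔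
      x - y ∈ Ideal.span {(p : R) ^ m} := by
    intro m x y
    rw [SModEq.sub_mem, smul_eq_mul, Ideal.mul_top, Ideal.span_singleton_pow]
  have main := aux_main (A := Matrix (Fin n) (Fin n) R) p (by
      intro M hM
      ext i j
      refine IsHausdorff.haus (I := Ideal.span {(p : R)}) inferInstance _ fun m => ?_
      rw [hsm, sub_zero]
      exact (aux_matrix p n m M).1 (hM m) i j) (by
      intro s hs
      have : ∀ i j, ∃ L : R, ∀ m, s m i j - L ∈ Ideal.span {(p : R) ^ m} := by
        intro i j
        obtain ⟨L, hL⟩ := IsPrecomplete.prec (I := Ideal.span {(p : R)}) (M := R) inferInstance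
          (f := fun m => s m i j) (by
            intro m l hml
            rw [hsm]
            exact (aux_matrix p n m _).1 (hs m l hml) i j)
        exact ⟨L, fun m => (hsm _ _ _).1 (hL m)⟩
      choose L hL using this
      exact ⟨Matrix.of L, fun m => (aux_matrix p n m _).2 fun i j => hL i j m⟩)
    k hk g ((aux_matrix p n k _).2 hg)
  simp only [aux_matrix] at main
  exact main
end
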